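/- The polynomial p(x) = x⁸ − x⁶ − x⁴ − x² + 1 has exactly four real roots. There is a unique real root q₀ with q₀ > 1, and the set of real roots of p is exactly {q₀, q₀⁻¹, −q₀, −q₀⁻¹}. -/

import Mathlib

/-- Two nonzero real roots of x⁸ − x⁶ − x⁴ − x² + 1 agree up to sign and inversion. -/
lemma sq_eq_or_mul_sq_eq_one_of_roots {x q : ℝ} (hx0 : x ≠ 0) (hq0 : q ≠ 0)
    (hx : x^8 - x^6 - x^4 - x^2 + 1 = 0) (hq : q^8 - q^6 - q^4 - q^2 + 1 = 0) :
    x^2 = q^2 ∨ (x * q)^2 = 1 := by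
  have hprod : ((x^2 - q^2) * ((x * q)^2 - 1)) *
      (q^2 * x^4 + q^2 + x^2 * q^4 + x^2 - x^2 * q^2) = 0 := by
    linear_combination q^4 * hx - x^4 * hq
  have hpos : 0 < q^2 * x^4 + q^2 + x^2 * q^4 + x^2 - x^2 * q^2 := by
    have hx2 : 0 < x^2 := by positivity
    have hq2 : 0 < q^2 := by positivity
    have h : 0 ≤ q^2 * (x^2 - 1)^2 := by positivity
    have h' : 0 < x^2 * q^4 + q^2 * x^2 + x^2 := by positivity
    nlinarith
  rcases mul_eq_zero.mp ((mul_eq_zero.mp hprod).resolve_right hpos.ne') with h | h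
  · exact Or.inl (sub_eq_zero.mp h)
  · exact Or.inr (sub_eq_zero.mp h)

lemma exists_root_gt_one : ∃ q : ℝ, 1 < q ∧ q^8 - q^6 - q^4 - q^2 + 1 = 0 := by
  have hc : ContinuousOn (fun q : ℝ => q^8 - q^6 - q^4 - q^2 + 1) (Set.Icc 1 2) := by
    fun_prop
  obtain ⟨q, hq, h⟩ := intermediate_value_Ioo (by norm_num) hc
    (show (0 : ℝ) ∈ Set.Ioo _ _ by constructor <;> norm_num)
  exact ⟨q, hq.1, h⟩

/-- The polynomial x⁸ − x⁶ − x⁴ − x² + 1 has exactly four real roots: there is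
a unique real root q₀ > 1, and the real roots are exactly ±q₀^{±1}. -/
theorem stmt_10 :
    ∃ q₀ : ℝ, 1 < q₀ ∧
      (q₀^8 - q₀^6 - q₀^4 - q₀^2 + 1 = 0) ∧
      (∀ q : ℝ, 1 < q → q^8 - q^6 - q^4 - q^2 + 1 = 0 → q = q₀) ∧
      {x : ℝ | x^8 - x^6 - x^4 - x^2 + 1 = 0} = {q₀, q₀⁻¹, -q₀, -q₀⁻¹} ∧
      ({q₀, q₀⁻¹, -q₀, -q₀⁻¹} : Set ℝ).ncard = 4 := by
  obtain ⟨q₀, h1, hq⟩ := exists_root_gt_one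
  have hpos : 0 < q₀ := by linarith
  have hinv : q₀⁻¹ < 1 := inv_lt_one_of_one_lt₀ h1
  have hinv0 : 0 < q₀⁻¹ := inv_pos.mpr hpos
  have hqinv : q₀⁻¹^8 - q₀⁻¹^6 - q₀⁻¹^4 - q₀⁻¹^2 + 1 = 0 := by
    field_simp
    linear_combination hq
  refine ⟨q₀, h1, hq, ?_, ?_, ?_⟩
  · intro q hq1 h
    rcases sq_eq_or_mul_sq_eq_one_of_roots (by linarith) hpos.ne' h hq with h | h
    · exact (sq_eq_sq₀ (by linarith) hpos.le).mp h
    · nlinarith [mul_pos (sub_pos.mpr hq1) (sub_pos.mpr h1)]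
  · ext x
    simp only [Set.mem_ofPred_eq, Set.mem_insert_iff, Set.mem_singleton_iff]
    constructor
    · intro h
      have hx0 : x ≠ 0 := by
        rintro rfl
        norm_num at h
      rcases sq_eq_or_mul_sq_eq_one_of_roots hx0 hpos.ne' h hq with h | h
      · rcases sq_eq_sq_iff_eq_or_eq_neg.mp h with h | h <;> simp [h]
      · rcases mul_self_eq_one_iff.mp (by rwa [sq] at h) with h | h
        · exact Or.inr (Or.inl (eq_inv_of_mul_eq_one_left h))
        · refine Or.inr (Or.inr (Or.inr ?_))
          rw [← eq_inv_of_mul_eq_one_left (show -x * q₀ = 1 by linarith), neg_neg]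
    · rintro (rfl | rfl | rfl | rfl)
      · exact hq
      · exact hqinv
      · linear_combination hq
      · linear_combination hqinv
  · rw [Set.ncard_insert_of_notMem, Set.ncard_insert_of_notMem, Set.ncard_pair]
    · intro h
      linarith
    · rintro (h | h)
      · linarith
      · rw [Set.mem_singleton_iff] at h
        linarith
    · rintro (h | h | h)
      · linarith
      · linarith
      · rw [Set.mem_singleton_iff] at h
        linarith
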